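/- Let V be a finite-dimensional vector space over the field 𝔽₃ = ℤ/3ℤ and let λ : V × V × V → 𝔽₃ be a symmetric trilinear form. Then the characteristic element γ(λ) : v ↦ λ(v, v, v) lies in the image of the second adjoint of λ: there exist finitely many pairs of vectors (u₁, v₁), …, (u_k, v_k) in V × V such that λ(w, w, w) = Σᵢ λ(uᵢ, vᵢ, w) for all w ∈ V. -/

import Mathlib

/-- The diagonal `w ↦ L w w w` of a symmetric trilinear form in characteristic three, as a linear
functional. -/
def trilinearDiagonal {V : Type*} [AddCommGroup V] [Module (ZMod 3) V]
    (L : V →ₗ[ZMod 3] V →ₗ[ZMod 3] V →ₗ[ZMod 3] ZMod 3)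
    (h₁₂ : ∀ a b c, L a b c = L b a c) (h₂₃ : ∀ a b c, L a b c = L a c b) :
    Module.Dual (ZMod 3) V where
  toFun w := L w w w
  map_add' a b := by
    have three : (3 : ZMod 3) = 0 := rfl
    simp only [map_add, LinearMap.add_apply]
    rw [h₁₂ b a a, h₂₃ a b a, h₁₂ b a b, h₂₃ b b a, h₁₂ b a b]
    linear_combination (L a a b + L a b b) * three
  map_smul' c w := by
    have cube : ∀ c : ZMod 3, c * (c * c) = c := by decide
    simp only [map_smul, LinearMap.smul_apply, smul_eq_mul, RingHom.id_apply]
    linear_combination (L w w w) * cube c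

/-- Let `V` be a finite-dimensional `𝔽₃ = ℤ/3ℤ` vector space and
`L` a symmetric trilinear form on `V`.  Then the characteristic element
`γ(L) : w ↦ L w w w` lies in the image of the second adjoint of `L`: there are
finitely many pairs `(uᵢ, vᵢ)` with `L w w w = Σᵢ L uᵢ vᵢ w` for all `w`. -/
theorem characteristic_element_in_image_of_second_adjoint
    {V : Type*} [AddCommGroup V] [Module (ZMod 3) V] [FiniteDimensional (ZMod 3) V]
    (L : V →ₗ[ZMod 3] V →ₗ[ZMod 3] V →ₗ[ZMod 3] ZMod 3)
    (hsymm : ∀ (σ : Equiv.Perm (Fin 3)) (v : Fin 3 → V),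
      L (v 0) (v 1) (v 2) = L (v (σ 0)) (v (σ 1)) (v (σ 2))) :
    ∃ (k : ℕ) (u v : Fin k → V), ∀ w : V, L w w w = ∑ i, L (u i) (v i) w := by
  have h₁₂ : ∀ a b c, L a b c = L b a c := fun a b c => hsymm (Equiv.swap 0 1) ![a, b, c]
  have h₂₃ : ∀ a b c, L a b c = L a c b := fun a b c => hsymm (Equiv.swap 1 2) ![a, b, c]
  let S : Set (Module.Dual (ZMod 3) V) := Set.range fun p : V × V => L p.1 p.2
  have hmem : trilinearDiagonal L h₁₂ h₂₃ ∈ Submodule.span (ZMod 3) S := by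
    rw [← Subspace.dualCoannihilator_dualAnnihilator_eq (W := Submodule.span (ZMod 3) S),
      Submodule.mem_dualAnnihilator]
    intro w hw
    exact (Submodule.mem_dualCoannihilator _).1 hw (L w w) (Submodule.subset_span ⟨(w, w), rfl⟩)
  obtain ⟨k, c, g, hg⟩ := Submodule.mem_span_set'.1 hmem
  choose p hp using fun i => (g i).2
  refine ⟨k, fun i => c i • (p i).1, fun i => (p i).2, fun w => ?_⟩
  have hw : (∑ i, c i • (g i : Module.Dual (ZMod 3) V)) w = L w w w := by rw [hg]; rfl
  rw [← hw, LinearMap.sum_apply]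
  refine Finset.sum_congr rfl fun i _ => ?_
  rw [← hp i, map_smul]
  rfl
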